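/- arXiv:2010.08986 — 3 statements merged into one kernel-verified Lean document; each statement's English description precedes it below -/
import Mathlib

section
/- (Maximal monotonicity of the subdifferential.) Let f : E → ℝ be convex. If x, z ∈ E are such that ⟪x − x', z − z'⟫ ≥ 0 for every x' ∈ E and every subgradient z' ∈ ∂f(x'), then z ∈ ∂f(x). -/
open RealInnerProductSpace

/-- A continuous convex function on a Hilbert space has a subgradient at every point. -/
theorem ConvexOn.exists_subgradient {E : Type*} [NormedAddCommGroup E] [InnerProductSpace ℝ E]
    [CompleteSpace E] {f : E → ℝ} (hf : ConvexOn ℝ Set.univ f) (hc : Continuous f) (x : E) :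
    ∃ z : E, ∀ y, f x + ⟪z, y - x⟫ ≤ f y := by
  have hconvex : Convex ℝ {p : E × ℝ | f p.1 < p.2} := by
    simpa using hf.convex_strict_epigraph
  have hopen : IsOpen {p : E × ℝ | f p.1 < p.2} :=
    isOpen_lt (hc.comp continuous_fst) continuous_snd
  obtain ⟨L, hL⟩ := geometric_hahn_banach_open_point hconvex hopen
    (x := (x, f x)) (lt_irrefl (f x))
  set g : E →L[ℝ] ℝ := L.comp (ContinuousLinearMap.inl ℝ E ℝ)
  set c : ℝ := L (0, 1)
  have hsplit : ∀ (p : E) (r : ℝ), L (p, r) = g p + r * c := fun p r => by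
    have hp : ((p, r) : E × ℝ) = (p, 0) + r • (0, 1) := by simp
    rw [hp, map_add, map_smul, smul_eq_mul]
    rfl
  have hlt : ∀ (p : E) (r : ℝ), f p < r → g p + r * c < g x + f x * c := fun p r hr => by
    simpa only [hsplit] using hL (p, r) hr
  have hneg : c < 0 := by linarith [hlt x (f x + 1) (lt_add_one _)]
  refine ⟨(InnerProductSpace.toDual ℝ E).symm ((-c)⁻¹ • g), fun y => ?_⟩
  rw [InnerProductSpace.toDual_symm_apply, smul_apply, map_sub, smul_eq_mul]
  refine le_of_forall_gt_imp_ge_of_dense fun r hr => ?_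
  have key := hlt y r hr
  have hbound : (-c)⁻¹ * (g y - g x) ≤ r - f x := by
    rw [inv_mul_le_iff₀ (neg_pos.mpr hneg)]
    linarith
  linarith

/-- Maximal monotonicity of the subdifferential of a convex function `f : E → ℝ`:
if `⟪x - x', z - z'⟫ ≥ 0` for every `x'` and every subgradient `z'` of `f` at `x'`,
then `z` is a subgradient of `f` at `x`. -/
theorem subdifferential_maximal_monotone {d : ℕ} (hd : 1 ≤ d)
    (f : EuclideanSpace ℝ (Fin d) → ℝ)
    (hconv : ∀ x y : EuclideanSpace ℝ (Fin d), ∀ t : ℝ, 0 ≤ t → t ≤ 1 →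
      f (t • x + (1 - t) • y) ≤ t * f x + (1 - t) * f y)
    (x z : EuclideanSpace ℝ (Fin d))
    (h : ∀ x' z' : EuclideanSpace ℝ (Fin d),
      (∀ y, f x' + ⟪z', y - x'⟫ ≤ f y) → 0 ≤ ⟪x - x', z - z'⟫) :
    ∀ y, f x + ⟪z, y - x⟫ ≤ f y := by
  intro y
  have hf : ConvexOn ℝ Set.univ f := by
    refine ⟨convex_univ, fun u _ v _ a b ha hb hab => ?_⟩
    obtain rfl : b = 1 - a := by linarith
    exact hconv u v a ha (by linarith)
  have hc : Continuous f := continuousOn_univ.mp (hf.continuousOn isOpen_univ)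
  have hseg : ∀ t ∈ Set.Ioo (0 : ℝ) 1,
      f (x + t • (y - x)) + (1 - t) * ⟪z, y - x⟫ ≤ f y := by
    rintro t ⟨ht0, ht1⟩
    obtain ⟨w, hw⟩ := hf.exists_subgradient hc (x + t • (y - x))
    have hmono := h _ w hw
    have hsub := hw y
    rw [show x - (x + t • (y - x)) = (-t) • (y - x) by module, real_inner_smul_left,
      real_inner_comm, inner_sub_left] at hmono
    rw [show y - (x + t • (y - x)) = (1 - t) • (y - x) by module, real_inner_smul_right] at hsub
    have hle : ⟪z, y - x⟫ ≤ ⟪w, y - x⟫ := by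
      by_contra hlt
      nlinarith
    nlinarith
  have hlim : Filter.Tendsto (fun t : ℝ => f (x + t • (y - x)) + (1 - t) * ⟪z, y - x⟫)
      (nhdsWithin 0 (Set.Ioi 0)) (nhds (f x + ⟪z, y - x⟫)) := by
    have hcont : Continuous fun t : ℝ => f (x + t • (y - x)) + (1 - t) * ⟪z, y - x⟫ := by
      fun_prop
    simpa using (hcont.tendsto 0).mono_left nhdsWithin_le_nhds
  exact le_of_tendsto hlim (Filter.mem_of_superset (Ioo_mem_nhdsGT one_pos) hseg)
end

section
/- (Cross-monotonicity estimate for two Yosida approximations.) For all m, n > 0 and all x, x' ∈ ℝ, (x − x')·(∇ψ_n(x) − ∇ψ_m(x')) ≥ −(1/n + 1/m)·∇ψ_n(x)·∇ψ_m(x'). -/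
/-- A minimizer `p` over `D` of `y ↦ k/2 (y - x)² + ψ y` satisfies `k (x - p) ∈ ∂ψ(p)`. -/
theorem ConvexOn.mul_sub_le_of_proximal_minimizer {D : Set ℝ} {ψ : ℝ → ℝ}
    (hψ : ConvexOn ℝ D ψ) {k x p z : ℝ} (hk : 0 < k) (hp : p ∈ D)
    (hmin : ∀ y ∈ D, k / 2 * (p - x) ^ 2 + ψ p ≤ k / 2 * (y - x) ^ 2 + ψ y) (hz : z ∈ D) :
    k * (x - p) * (z - p) ≤ ψ z - ψ p := by
  set A := ψ z - ψ p - k * (x - p) * (z - p) with hA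
  set B := k / 2 * (z - p) ^ 2 with hB
  have hB0 : 0 ≤ B := by positivity
  have key : ∀ t : ℝ, 0 < t → t ≤ 1 → 0 ≤ A + t * B := by
    intro t ht ht1
    have hmem := hψ.1 hp hz (sub_nonneg.2 ht1) ht.le (by ring)
    have hconv := hψ.2 hp hz (sub_nonneg.2 ht1) ht.le (by ring)
    have hle := hmin _ hmem
    simp only [smul_eq_mul] at hconv hle
    have h : 0 ≤ t * (A + t * B) := by
      rw [hA, hB]
      linarith
    exact nonneg_of_mul_nonneg_right h ht
  suffices 0 ≤ A by linarith
  by_contra! hneg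
  have hpos : 0 < B - A := by linarith
  have h := key (-A / (B - A)) (div_pos (by linarith) hpos) ((div_le_one hpos).2 (by linarith))
  have heq : A + -A / (B - A) * B = -(A ^ 2 / (B - A)) := by
    field_simp
    ring
  have : 0 < A ^ 2 / (B - A) := div_pos (by nlinarith) hpos
  linarith

/-- Cross-monotonicity estimate for two Yosida approximations: for all `m, n > 0`
and all `x, x' ∈ ℝ`,
`(x - x')(∇ψₙ(x) - ∇ψₘ(x')) ≥ -(1/n + 1/m) ∇ψₙ(x) ∇ψₘ(x')`,
where `∇ψₖ(x) = k(x - Jₖx)`. -/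
theorem yosida_cross_monotonicity
    (D : Set ℝ) (hDne : D.Nonempty) (hDcl : IsClosed D) (hDconv : Convex ℝ D)
    (h0 : (0 : ℝ) ∈ D)
    (ψ : ℝ → ℝ) (hψconv : ConvexOn ℝ D ψ) (hψlsc : LowerSemicontinuousOn ψ D)
    (hψ0 : ψ 0 = 0) (hψnn : ∀ y ∈ D, 0 ≤ ψ y)
    (J : ℝ → ℝ → ℝ)
    (hJ : ∀ k : ℝ, 0 < k → ∀ x : ℝ, J k x ∈ D ∧
      ∀ z ∈ D, k / 2 * (J k x - x) ^ 2 + ψ (J k x) ≤ k / 2 * (z - x) ^ 2 + ψ z)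
    (m n : ℝ) (hm : 0 < m) (hn : 0 < n) (x x' : ℝ) :
    -(1 / n + 1 / m) * (n * (x - J n x)) * (m * (x' - J m x')) ≤
      (x - x') * (n * (x - J n x) - m * (x' - J m x')) := by
  obtain ⟨hu, humin⟩ := hJ n hn x
  obtain ⟨hv, hvmin⟩ := hJ m hm x'
  have h₁ := hψconv.mul_sub_le_of_proximal_minimizer hn hu humin hv
  have h₂ := hψconv.mul_sub_le_of_proximal_minimizer hm hv hvmin hu
  have hcoef : -(1 / n + 1 / m) * (n * (x - J n x)) * (m * (x' - J m x')) =
      -((n + m) * (x - J n x) * (x' - J m x')) := by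
    field_simp
    ring
  rw [hcoef]
  have hsq₁ := mul_nonneg hn.le (sq_nonneg (x - J n x))
  have hsq₂ := mul_nonneg hm.le (sq_nonneg (x' - J m x'))
  linarith
end

section
/- (Existence of the Yamada–Watanabe-type auxiliary function g_{δ,h}.) For every δ ∈ (0,1) and every h > 0, there exists a measurable function f : ℝ → ℝ such that: f(γ) ≥ 0 for all γ; f(γ) = 0 for γ ∉ [hδ, h]; f(γ) ≤ 2/(γ·log(1/δ)) for all γ ∈ [hδ, h]; ∫_ℝ f(γ) dγ = 1; and the function g : ℝ → ℝ defined by g(x) := ∫₀^x ( ∫₀^y f(γ) dγ ) dy satisfies: (i) 0 ≤ ∫₀^y f(γ) dγ ≤ 1 for all y ≥ 0 (so g is nondecreasing and 1-Lipschitz on [0,∞) with g(0) = 0), and (ii) x ≤ g(x) + h for all x ≥ 0. -/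
open MeasureTheory intervalIntegral

/-- The primitive from `0` of a nonnegative function of total integral `1` takes values in
`[0, 1]` on the nonnegative half-line. -/
theorem primitive_mem_Icc {f : ℝ → ℝ} (hf : Integrable f) (h0 : ∀ γ, 0 ≤ f γ)
    (h1 : ∫ γ, f γ = 1) {y : ℝ} (hy : 0 ≤ y) :
    (∫ γ in (0:ℝ)..y, f γ) ∈ Set.Icc (0:ℝ) 1 := by
  refine ⟨integral_nonneg hy fun γ _ => h0 γ, ?_⟩
  rw [integral_of_le hy, ← h1]
  exact setIntegral_le_integral hf (.of_forall h0)

/-- The primitive from `0` of a function vanishing outside `[a, b]`, with `0 < a`, equals the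
total integral from `b` on. -/
theorem primitive_eq_integral {f : ℝ → ℝ} {a b y : ℝ} (ha : 0 < a)
    (hs : ∀ γ, γ ∉ Set.Icc a b → f γ = 0) (hy : 0 ≤ y) (hby : b ≤ y) :
    ∫ γ in (0:ℝ)..y, f γ = ∫ γ, f γ := by
  rw [integral_of_le hy]
  refine setIntegral_eq_integral_of_forall_compl_eq_zero fun γ hγ => hs γ fun hγ' => hγ ?_
  exact ⟨ha.trans_le hγ'.1, hγ'.2.trans hby⟩

/-- The density `1 / (γ log (b / a))` on `[a, b]` has total integral `1`. -/
theorem integral_indicator_inv_mul_log {a b : ℝ} (ha : 0 < a) (hab : a < b) :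
    ∫ γ, (Set.Icc a b).indicator (fun γ => γ⁻¹ * (Real.log (b / a))⁻¹) γ = 1 := by
  have hL : 0 < Real.log (b / a) := Real.log_pos ((one_lt_div ha).2 hab)
  rw [MeasureTheory.integral_indicator measurableSet_Icc, integral_Icc_eq_integral_Ioc,
    ← integral_of_le hab.le, intervalIntegral.integral_mul_const,
    integral_inv_of_pos ha (ha.trans hab), mul_inv_cancel₀ hL.ne']

theorem integrable_indicator_inv_mul_const {a b : ℝ} (ha : 0 < a) (c : ℝ) :
    Integrable ((Set.Icc a b).indicator fun γ : ℝ => γ⁻¹ * c) := by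
  rw [integrable_indicator_iff measurableSet_Icc]
  refine ContinuousOn.integrableOn_Icc (ContinuousOn.mul ?_ continuousOn_const)
  exact continuousOn_id.inv₀ fun x hx => (ha.trans_le hx.1).ne'

/-- Existence of the Yamada–Watanabe-type auxiliary function `g_{δ,h}`: for every
`δ ∈ (0,1)` and `h > 0` there is a measurable `f ≥ 0`, supported in `[hδ, h]`,
with `f(γ) ≤ 2/(γ log(1/δ))` on `[hδ, h]` and total integral `1`, such that
`g(x) = ∫₀ˣ ∫₀ʸ f(γ) dγ dy` satisfies `0 ≤ ∫₀ʸ f ≤ 1` for `y ≥ 0` (so `g` is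
nondecreasing and 1-Lipschitz on `[0,∞)` with `g(0) = 0`) and `x ≤ g(x) + h`
for all `x ≥ 0`. -/
theorem exists_yamada_watanabe_function (δ h : ℝ) (hδ0 : 0 < δ) (hδ1 : δ < 1)
    (hh : 0 < h) :
    ∃ f : ℝ → ℝ, Measurable f ∧
      (∀ γ : ℝ, 0 ≤ f γ) ∧
      (∀ γ : ℝ, γ ∉ Set.Icc (h * δ) h → f γ = 0) ∧
      (∀ γ ∈ Set.Icc (h * δ) h, f γ ≤ 2 / (γ * Real.log (1 / δ))) ∧
      (∫ γ : ℝ, f γ) = 1 ∧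
      ∃ g : ℝ → ℝ, g = (fun x => ∫ y in (0:ℝ)..x, ∫ γ in (0:ℝ)..y, f γ) ∧
        (∀ y : ℝ, 0 ≤ y → 0 ≤ (∫ γ in (0:ℝ)..y, f γ) ∧ (∫ γ in (0:ℝ)..y, f γ) ≤ 1) ∧
        MonotoneOn g (Set.Ici 0) ∧
        LipschitzOnWith 1 g (Set.Ici 0) ∧
        g 0 = 0 ∧
        (∀ x : ℝ, 0 ≤ x → x ≤ g x + h) := by
  have ha : 0 < h * δ := mul_pos hh hδ0
  have hab : h * δ < h := mul_lt_of_lt_one_right hh hδ1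
  have hL : 0 < Real.log (1 / δ) := Real.log_pos ((one_lt_div hδ0).2 hδ1)
  have hdiv : h / (h * δ) = 1 / δ := by field_simp
  set f : ℝ → ℝ :=
    (Set.Icc (h * δ) h).indicator fun γ => γ⁻¹ * (Real.log (1 / δ))⁻¹ with hf
  have hfi : Integrable f := integrable_indicator_inv_mul_const ha _
  have hf0 : ∀ γ, 0 ≤ f γ := Set.indicator_nonneg fun γ hγ =>
    mul_nonneg (inv_nonneg.2 (ha.le.trans hγ.1)) (inv_nonneg.2 hL.le)
  have hfs : ∀ γ, γ ∉ Set.Icc (h * δ) h → f γ = 0 := fun γ hγ =>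
    Set.indicator_of_notMem hγ _
  have hf1 : ∫ γ, f γ = 1 := by
    simpa only [hdiv] using integral_indicator_inv_mul_log ha hab
  have hF := fun y (hy : 0 ≤ y) => primitive_mem_Icc hfi hf0 hf1 hy
  have hFi : ∀ a b : ℝ,
      IntervalIntegrable (fun y => ∫ γ in (0:ℝ)..y, f γ) volume a b :=
    (continuous_primitive (fun _ _ => hfi.intervalIntegrable) 0).intervalIntegrable
  refine ⟨f, (by fun_prop : Measurable fun γ : ℝ => γ⁻¹ * _).indicator measurableSet_Icc,
    hf0, hfs, fun γ hγ => ?_, hf1, _, rfl, hF, fun x hx y _ hxy => ?_,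
    LipschitzOnWith.of_dist_le_mul fun x hx y hy => ?_, integral_same, fun x hx => ?_⟩
  · have hγ0 : 0 < γ := ha.trans_le hγ.1
    rw [hf, Set.indicator_of_mem hγ, ← mul_inv, ← one_div]
    gcongr
    norm_num
  · rw [← sub_nonneg, integral_interval_sub_left (hFi _ _) (hFi _ _)]
    exact integral_nonneg hxy fun u hu => (hF u (le_trans hx hu.1)).1
  · rw [Real.dist_eq, Real.dist_eq, integral_interval_sub_left (hFi _ _) (hFi _ _),
      ← Real.norm_eq_abs]
    refine intervalIntegral.norm_integral_le_of_norm_le_const fun u hu => ?_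
    have hu0 : 0 ≤ u := (le_min hy hx).trans hu.1.le
    rw [Real.norm_of_nonneg (hF u hu0).1]
    exact (hF u hu0).2
  · have hg : ∀ z : ℝ, 0 ≤ z → 0 ≤ ∫ y in (0:ℝ)..z, ∫ γ in (0:ℝ)..y, f γ :=
      fun z hz => integral_nonneg hz fun u hu => (hF u hu.1).1
    rcases le_total x h with hxh | hhx
    · linarith [hg x hx]
    · have htail : ∫ y in h..x, ∫ γ in (0:ℝ)..y, f γ = x - h := by
        rw [integral_congr (g := fun _ => (1 : ℝ)), intervalIntegral.integral_const,
          smul_eq_mul, mul_one]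
        intro u hu
        rw [Set.uIcc_of_le hhx] at hu
        exact (primitive_eq_integral ha hfs (hh.le.trans hu.1) hu.1).trans hf1
      have hadd := integral_add_adjacent_intervals (hFi 0 h) (hFi h x)
      linarith [hg h hh.le]
end
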